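/- arXiv:2410.06381 — 3 statements merged into one kernel-verified Lean document; each statement's English description precedes it below -/
import Mathlib

section
/- Let p ≥ r ≥ 1, let U, Û ∈ ℝ^{p×r} each have orthonormal columns, and let U_⊥ ∈ ℝ^{p×(p−r)} have orthonormal columns with U_⊥ᵀU = 0 (so that the columns of U and U_⊥ together form an orthonormal basis of ℝ^p). Then there exists an orthogonal matrix W ∈ ℝ^{r×r} such that ‖UᵀÛ − W‖ ≤ ‖U_⊥ᵀÛ‖², where ‖·‖ is the spectral norm. -/
open MeasureTheory ProbabilityTheory Matrix
open scoped ENNReal NNReal Kronecker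

noncomputable section

/-- The Euclidean norm of a finitely indexed real vector. -/
def euclNorm {n : Type*} [Fintype n] (x : n → ℝ) : ℝ :=
  Real.sqrt (∑ i, x i ^ 2)

/-- `‖M‖_{2,∞}`, the largest row `ℓ₂`-norm of a matrix. -/
def norm2inf {m n : Type*} [Fintype m] [Fintype n] (M : Matrix m n ℝ) : ℝ :=
  ⨆ i, euclNorm fun j => M i j

/-- The spectral norm (largest singular value) of a real matrix, realized as the
`ℓ₂ → ℓ₂` operator norm. -/
def specNorm {m n : Type*} [Fintype m] [Fintype n] [DecidableEq n] (M : Matrix m n ℝ) : ℝ :=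
  ‖LinearMap.toContinuousLinearMap (Matrix.toEuclideanLin M)‖

/-- `sValGe A r c` says that the `r`-th largest singular value of `A` is at least `c`,
expressed through the Courant–Fischer min-max characterization. -/
def sValGe {m n : Type*} [Fintype m] [Fintype n] [DecidableEq n]
    (A : Matrix m n ℝ) (r : ℕ) (c : ℝ) : Prop :=
  ∃ V : Submodule ℝ (EuclideanSpace ℝ n), Module.finrank ℝ V = r ∧
    ∀ x ∈ V, c * ‖x‖ ≤ ‖Matrix.toEuclideanLin A x‖

/-- The Tucker (mode-wise) product `T ×₁ A₁ ×₂ A₂ ×₃ A₃` of an order-3 tensor with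
three matrices. -/
def tuckerProd {n₁ n₂ n₃ q₁ q₂ q₃ : ℕ} (T : Fin n₁ → Fin n₂ → Fin n₃ → ℝ)
    (A₁ : Matrix (Fin q₁) (Fin n₁) ℝ) (A₂ : Matrix (Fin q₂) (Fin n₂) ℝ)
    (A₃ : Matrix (Fin q₃) (Fin n₃) ℝ) : Fin q₁ → Fin q₂ → Fin q₃ → ℝ :=
  fun i j k => ∑ a, ∑ b, ∑ c, T a b c * A₁ i a * A₂ j b * A₃ k c

/-- Mode-1 matricization; the column pair `(b, c)` corresponds to `(b-1)p₃ + c`. -/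
def mat1 {n₁ n₂ n₃ : ℕ} (T : Fin n₁ → Fin n₂ → Fin n₃ → ℝ) :
    Matrix (Fin n₁) (Fin n₂ × Fin n₃) ℝ :=
  Matrix.of fun a bc => T a bc.1 bc.2

/-- Mode-2 matricization; the column pair `(c, a)` corresponds to `(c-1)p₁ + a`. -/
def mat2 {n₁ n₂ n₃ : ℕ} (T : Fin n₁ → Fin n₂ → Fin n₃ → ℝ) :
    Matrix (Fin n₂) (Fin n₃ × Fin n₁) ℝ :=
  Matrix.of fun b ca => T ca.2 b ca.1

/-- Mode-3 matricization; the column pair `(a, b)` corresponds to `(a-1)p₂ + b`. -/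
def mat3 {n₁ n₂ n₃ : ℕ} (T : Fin n₁ → Fin n₂ → Fin n₃ → ℝ) :
    Matrix (Fin n₃) (Fin n₁ × Fin n₂) ℝ :=
  Matrix.of fun c ab => T ab.1 ab.2 c

/-- The law of `T + Z`, where `Z` has independent `N(0, σ_{abc}²)` entries: the product of
Gaussian measures with means `T_{abc}` and variances `σ_{abc}²`. -/
def lawOf {p₁ p₂ p₃ : ℕ} (Tm : Fin p₁ → Fin p₂ → Fin p₃ → ℝ)
    (sd : Fin p₁ → Fin p₂ → Fin p₃ → ℝ≥0) :
    Measure (Fin p₁ → Fin p₂ → Fin p₃ → ℝ) :=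
  Measure.pi fun a => Measure.pi fun b => Measure.pi fun c =>
    gaussianReal (Tm a b c) (sd a b c ^ 2)

/-- Covariance matrix of a vector-valued random variable. -/
def covMatrix {D : Type*} [MeasurableSpace D] (μ : Measure D) {r : ℕ} (f : D → Fin r → ℝ) :
    Matrix (Fin r) (Fin r) ℝ :=
  Matrix.of fun s t =>
    ∫ x, (f x s - ∫ y, f y s ∂μ) * (f x t - ∫ y, f y t ∂μ) ∂μ

/-- A parameter `θ = (S, U₁, U₂, U₃, (σ_{abc}))` of the tensor denoising model. -/
structure TuckerParam (p₁ p₂ p₃ r₁ r₂ r₃ : ℕ) where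
  core : Fin r₁ → Fin r₂ → Fin r₃ → ℝ
  U1 : Matrix (Fin p₁) (Fin r₁) ℝ
  U2 : Matrix (Fin p₂) (Fin r₂) ℝ
  U3 : Matrix (Fin p₃) (Fin r₃) ℝ
  sd : Fin p₁ → Fin p₂ → Fin p₃ → ℝ≥0

/-- The signal tensor `T(θ) = S ×₁ U₁ ×₂ U₂ ×₃ U₃`. -/
def TuckerParam.T {p₁ p₂ p₃ r₁ r₂ r₃ : ℕ} (θ : TuckerParam p₁ p₂ p₃ r₁ r₂ r₃) :
    Fin p₁ → Fin p₂ → Fin p₃ → ℝ :=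
  tuckerProd θ.core θ.U1 θ.U2 θ.U3

/-- `P_θ`, the law of `T(θ) + Z` where `Z` has independent `N(0, σ_{abc}²)` entries. -/
def TuckerParam.law {p₁ p₂ p₃ r₁ r₂ r₃ : ℕ} (θ : TuckerParam p₁ p₂ p₃ r₁ r₂ r₃) :
    Measure (Fin p₁ → Fin p₂ → Fin p₃ → ℝ) :=
  lawOf θ.T θ.sd

/-- Membership in the parameter class `Θ(λ, κ, μ₀, σ, σ_min)`, with absolute constant `C₀`.
The rank/singular-value condition on the matricizations of the core is expressed through the
equivalent two-sided bound `λ‖x‖ ≤ ‖xᵀ M_k(S)‖ ≤ κλ‖x‖`. -/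
def InTheta {p₁ p₂ p₃ r₁ r₂ r₃ : ℕ} (lam kap mu0 sig sigmin C0 : ℝ)
    (θ : TuckerParam p₁ p₂ p₃ r₁ r₂ r₃) : Prop :=
  θ.U1ᵀ * θ.U1 = 1 ∧ θ.U2ᵀ * θ.U2 = 1 ∧ θ.U3ᵀ * θ.U3 = 1 ∧
  norm2inf θ.U1 ≤ mu0 * Real.sqrt ((r₁ : ℝ) / (p₁ : ℝ)) ∧
  norm2inf θ.U2 ≤ mu0 * Real.sqrt ((r₂ : ℝ) / (p₂ : ℝ)) ∧
  norm2inf θ.U3 ≤ mu0 * Real.sqrt ((r₃ : ℝ) / (p₃ : ℝ)) ∧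
  (∀ x : Fin r₁ → ℝ, lam * euclNorm x ≤ euclNorm (Matrix.vecMul x (mat1 θ.core)) ∧
    euclNorm (Matrix.vecMul x (mat1 θ.core)) ≤ kap * lam * euclNorm x) ∧
  (∀ x : Fin r₂ → ℝ, lam * euclNorm x ≤ euclNorm (Matrix.vecMul x (mat2 θ.core)) ∧
    euclNorm (Matrix.vecMul x (mat2 θ.core)) ≤ kap * lam * euclNorm x) ∧
  (∀ x : Fin r₃ → ℝ, lam * euclNorm x ≤ euclNorm (Matrix.vecMul x (mat3 θ.core)) ∧
    euclNorm (Matrix.vecMul x (mat3 θ.core)) ≤ kap * lam * euclNorm x) ∧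
  C0 * kap * ((max r₁ (max r₂ r₃) : ℕ) : ℝ) * Real.sqrt ((max p₁ (max p₂ p₃) : ℕ) : ℝ)
    ≤ lam / sig ∧
  kap ≤ ((min p₁ (min p₂ p₃) : ℕ) : ℝ) ^ ((1 : ℝ) / 4) ∧
  ((max r₁ (max r₂ r₃) : ℕ) : ℝ) ≤ Real.sqrt ((min p₁ (min p₂ p₃) : ℕ) : ℝ) ∧
  ∀ a b c, sigmin ≤ (θ.sd a b c : ℝ) ∧ (θ.sd a b c : ℝ) ≤ sig


/-- Singular value decomposition of an endomorphism of a Euclidean space. -/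
theorem exists_orthonormalBasis_apply_eq_norm_smul {E : Type*} [NormedAddCommGroup E]
    [InnerProductSpace ℝ E] [FiniteDimensional ℝ E] (T : E →ₗ[ℝ] E) :
    ∃ v w : OrthonormalBasis (Fin (Module.finrank ℝ E)) ℝ E, ∀ i, T (v i) = ‖T (v i)‖ • w i := by
  have hsymm := T.isSymmetric_adjoint_mul_self
  set v := hsymm.eigenvectorBasis rfl
  have horth {i j} (hij : i ≠ j) : inner ℝ (T (v i)) (T (v j)) = 0 := by
    have h : inner ℝ (T (v i)) (T (v j)) = inner ℝ (v i) ((T.adjoint * T) (v j)) := by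
      simp [LinearMap.adjoint_inner_right]
    rw [h, hsymm.apply_eigenvectorBasis rfl j, inner_smul_right,
      orthonormal_iff_ite.mp v.orthonormal, if_neg hij, mul_zero]
  have hnormalized : Orthonormal ℝ
      (({i | T (v i) ≠ 0} : Set _).domRestrict fun i => ‖T (v i)‖⁻¹ • T (v i)) := by
    refine ⟨fun i => ?_, fun i j hij => ?_⟩
    · simp [norm_smul, inv_mul_cancel₀ (norm_ne_zero_iff.mpr i.2)]
    · simp [inner_smul_left, inner_smul_right, horth (Subtype.coe_ne_coe.mpr hij)]
  obtain ⟨w, hw⟩ := hnormalized.exists_orthonormalBasis_extension_of_card_eq (by simp)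
  refine ⟨v, w, fun i => ?_⟩
  by_cases hi : T (v i) = 0
  · simp [hi]
  · rw [hw i hi, smul_smul, mul_inv_cancel₀ (norm_ne_zero_iff.mpr hi), one_smul]

theorem exists_linearIsometryEquiv_norm_sub_le {E F : Type*} [NormedAddCommGroup E]
    [InnerProductSpace ℝ E] [FiniteDimensional ℝ E] [NormedAddCommGroup F] [NormedSpace ℝ F]
    (T : E →ₗ[ℝ] E) (S : E →L[ℝ] F) (h : ∀ x, ‖T x‖ ^ 2 + ‖S x‖ ^ 2 = ‖x‖ ^ 2) :
    ∃ W : E ≃ₗᵢ[ℝ] E, ∀ x, ‖T x - W x‖ ≤ ‖S‖ ^ 2 * ‖x‖ := by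
  obtain ⟨v, w, hTw⟩ := exists_orthonormalBasis_apply_eq_norm_smul T
  refine ⟨v.equiv w (Equiv.refl _), fun x => ?_⟩
  have hbound (i) : |‖T (v i)‖ - 1| ≤ ‖S‖ ^ 2 := by
    have h1 := h (v i)
    rw [v.norm_eq_one] at h1
    have h2 : ‖S (v i)‖ ≤ ‖S‖ := by simpa using S.le_opNorm (v i)
    have h3 : ‖S (v i)‖ ^ 2 ≤ ‖S‖ ^ 2 := by gcongr
    have h4 := norm_nonneg (T (v i))
    rw [abs_le]
    constructor <;> nlinarith [sq_nonneg ‖S (v i)‖]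
  have hx : T x - v.equiv w (Equiv.refl _) x =
      ∑ i, ((‖T (v i)‖ - 1) * v.repr x i) • w i := by
    conv_lhs => rw [← v.sum_repr x]
    rw [map_sum, map_sum, ← Finset.sum_sub_distrib]
    refine Finset.sum_congr rfl fun i _ => ?_
    have hvw : v.equiv w (Equiv.refl _) (v i) = w i := by simp
    rw [map_smul, map_smul, hvw, sub_mul, sub_smul, one_mul, mul_comm, mul_smul, ← hTw i]
  refine le_of_sq_le_sq ?_ (by positivity)
  rw [hx, ← w.sum_sq_norm_inner_right, mul_pow, ← v.sum_sq_norm_inner_right x, Finset.mul_sum]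
  refine Finset.sum_le_sum fun i _ => ?_
  rw [w.orthonormal.inner_right_fintype, norm_mul, mul_pow, v.repr_apply_apply]
  gcongr
  exact hbound i

theorem norm_sq_toEuclideanLin {m n : Type*} [Fintype m] [Fintype n] [DecidableEq n]
    (A : Matrix m n ℝ) (x : EuclideanSpace ℝ n) :
    ‖Matrix.toEuclideanLin A x‖ ^ 2 = x.ofLp ⬝ᵥ ((Aᵀ * A) *ᵥ x.ofLp) := by
  rw [EuclideanSpace.real_norm_sq_eq, ← Matrix.mulVec_mulVec, Matrix.dotProduct_mulVec,
    Matrix.vecMul_transpose]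
  simp [dotProduct, sq]

theorem mul_transpose_add_mul_transpose_eq_one {m n₁ n₂ : Type*} [Fintype m] [Fintype n₁]
    [Fintype n₂] [DecidableEq m] [DecidableEq n₁] [DecidableEq n₂]
    (hcard : Fintype.card m = Fintype.card n₁ + Fintype.card n₂)
    {U : Matrix m n₁ ℝ} {V : Matrix m n₂ ℝ}
    (hU : Uᵀ * U = 1) (hV : Vᵀ * V = 1) (hVU : Vᵀ * U = 0) : U * Uᵀ + V * Vᵀ = 1 := by
  have hUV : Uᵀ * V = 0 := by simpa using congrArg Matrix.transpose hVU
  rw [← Matrix.fromCols_mul_fromRows]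
  refine (Matrix.mul_eq_one_comm_of_card_eq _ _ _ (by simpa using hcard)).mpr ?_
  rw [Matrix.fromRows_mul_fromCols, hU, hV, hVU, hUV, Matrix.fromBlocks_one]

/-- there is an orthogonal matrix within `‖sin Θ‖²` of `UᵀÛ`. -/
theorem stmt8 (p r : ℕ) (hr : 1 ≤ r) (hrp : r ≤ p)
    (U Uh : Matrix (Fin p) (Fin r) ℝ) (Uperp : Matrix (Fin p) (Fin (p - r)) ℝ)
    (hU : Uᵀ * U = 1) (hUh : Uhᵀ * Uh = 1)
    (hperp : Uperpᵀ * Uperp = 1) (horth : Uperpᵀ * U = 0) :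
    ∃ W : Matrix (Fin r) (Fin r) ℝ, Wᵀ * W = 1 ∧ W * Wᵀ = 1 ∧
      specNorm (Uᵀ * Uh - W) ≤ specNorm (Uperpᵀ * Uh) ^ 2 := by
  have hproj : U * Uᵀ + Uperp * Uperpᵀ = 1 :=
    mul_transpose_add_mul_transpose_eq_one (by simp [hrp]) hU hperp horth
  have hgram : (Uᵀ * Uh)ᵀ * (Uᵀ * Uh) + (Uperpᵀ * Uh)ᵀ * (Uperpᵀ * Uh) = 1 := by
    calc _ = Uhᵀ * (U * Uᵀ + Uperp * Uperpᵀ) * Uh := by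
          simp [Matrix.mul_assoc, Matrix.mul_add, Matrix.add_mul]
      _ = 1 := by rw [hproj, Matrix.mul_one, hUh]
  obtain ⟨W, hW⟩ := exists_linearIsometryEquiv_norm_sub_le (Matrix.toEuclideanLin (Uᵀ * Uh))
    (LinearMap.toContinuousLinearMap (Matrix.toEuclideanLin (Uperpᵀ * Uh))) fun x => by
      rw [LinearMap.coe_toContinuousLinearMap', norm_sq_toEuclideanLin, norm_sq_toEuclideanLin,
        ← dotProduct_add, ← Matrix.add_mulVec, hgram, Matrix.one_mulVec,
        EuclideanSpace.real_norm_sq_eq]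
      simp [dotProduct, sq]
  obtain ⟨M, hM⟩ := (Matrix.toEuclideanLin (𝕜 := ℝ)).surjective W.toLinearEquiv.toLinearMap
  have hMM : Mᵀ * M = 1 := by
    apply (Matrix.toEuclideanLin (𝕜 := ℝ)).injective
    rw [← Matrix.conjTranspose_eq_transpose_of_trivial, Matrix.toLpLin_mul_same,
      Matrix.toEuclideanLin_conjTranspose_eq_adjoint, hM]
    ext1 x
    refine ext_inner_right ℝ fun y => ?_
    simp [LinearMap.adjoint_inner_left]
  refine ⟨M, hMM, mul_eq_one_comm.mp hMM,
    ContinuousLinearMap.opNorm_le_bound _ (by positivity) fun x => ?_⟩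
  rw [LinearMap.coe_toContinuousLinearMap', map_sub, hM]
  exact hW x

end
end

section
/- Let T₁ ∈ ℝ^{p₁×(p₂p₃)} satisfy T₁ = T₁ · (U₂U₂ᵀ ⊗ U₃U₃ᵀ) for some U₂ ∈ ℝ^{p₂×r₂} and U₃ ∈ ℝ^{p₃×r₃} with orthonormal columns, and suppose the r₁-th largest singular value of T₁ is at least λ > 0. Let Û₂ ∈ ℝ^{p₂×r₂} and Û₃ ∈ ℝ^{p₃×r₃} have orthonormal columns with σ_min(U₂ᵀÛ₂) ≥ 7/8 and σ_min(U₃ᵀÛ₃) ≥ 7/8, where σ_min denotes the smallest singular value. Let Z₁ ∈ ℝ^{p₁×(p₂p₃)} satisfy ‖Z₁ · (Û₂Û₂ᵀ ⊗ Û₃Û₃ᵀ)‖ ≤ λ/8. Then the r₁-th largest singular value of (T₁ + Z₁) · (Û₂Û₂ᵀ ⊗ Û₃Û₃ᵀ) is at least (5/8)λ. -/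
open MeasureTheory ProbabilityTheory Matrix
open scoped ENNReal NNReal Kronecker

noncomputable section

theorem euclNorm_eq_norm {n : Type*} [Fintype n] (x : n → ℝ) :
    euclNorm x = ‖WithLp.toLp 2 x‖ := by
  simp [euclNorm, EuclideanSpace.norm_eq]

theorem sum_sq_le_of_euclNorm_le {m n : Type*} [Fintype m] [Fintype n] {c : ℝ} (hc : 0 ≤ c)
    {x : n → ℝ} {y : m → ℝ} (h : c * euclNorm x ≤ euclNorm y) :
    c ^ 2 * ∑ i, x i ^ 2 ≤ ∑ i, y i ^ 2 := by
  have hx : euclNorm x ^ 2 = ∑ i, x i ^ 2 := Real.sq_sqrt (Finset.sum_nonneg fun _ _ => sq_nonneg _)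
  have hy : euclNorm y ^ 2 = ∑ i, y i ^ 2 := Real.sq_sqrt (Finset.sum_nonneg fun _ _ => sq_nonneg _)
  rw [← hx, ← hy, ← mul_pow]
  exact pow_le_pow_left₀ (mul_nonneg hc (Real.sqrt_nonneg _)) h 2

/-- Lower bounds for matrices as operators multiply under Kronecker products. -/
theorem kronecker_mulVec_lower_bound {m n k l : Type*} [Fintype m] [Fintype n] [Fintype k]
    [Fintype l] {A : Matrix m k ℝ} {B : Matrix n l ℝ} {a b : ℝ} (ha : 0 ≤ a) (hb : 0 ≤ b)
    (hA : ∀ x, a * euclNorm x ≤ euclNorm (A *ᵥ x)) (hB : ∀ x, b * euclNorm x ≤ euclNorm (B *ᵥ x))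
    (z : k × l → ℝ) : a * b * euclNorm z ≤ euclNorm ((A ⊗ₖ B) *ᵥ z) := by
  have hAB : ∀ i j, ((A ⊗ₖ B) *ᵥ z) (i, j) = (A *ᵥ fun s => (B *ᵥ fun t => z (s, t)) j) i := by
    intro i j
    simp only [mulVec, dotProduct, Fintype.sum_prod_type, kroneckerMap_apply, Finset.mul_sum,
      mul_assoc]
  have key : (a * b) ^ 2 * ∑ p, z p ^ 2 ≤ ∑ p, ((A ⊗ₖ B) *ᵥ z) p ^ 2 :=
    calc (a * b) ^ 2 * ∑ p, z p ^ 2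
        = a ^ 2 * ∑ s, b ^ 2 * ∑ t, z (s, t) ^ 2 := by
          rw [Fintype.sum_prod_type, ← Finset.mul_sum]; ring
      _ ≤ a ^ 2 * ∑ s, ∑ j, (B *ᵥ fun t => z (s, t)) j ^ 2 := by
          gcongr with s
          exact sum_sq_le_of_euclNorm_le hb (hB _)
      _ = ∑ j, a ^ 2 * ∑ s, (B *ᵥ fun t => z (s, t)) j ^ 2 := by
          rw [Finset.sum_comm, Finset.mul_sum]
      _ ≤ ∑ j, ∑ i, (A *ᵥ fun s => (B *ᵥ fun t => z (s, t)) j) i ^ 2 := by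
          gcongr with j
          exact sum_sq_le_of_euclNorm_le ha (hA _)
      _ = ∑ p, ((A ⊗ₖ B) *ᵥ z) p ^ 2 := by
          rw [Finset.sum_comm, Fintype.sum_prod_type]
          simp only [hAB]
  refine Real.le_sqrt_of_sq_le ?_
  rw [mul_pow, euclNorm, Real.sq_sqrt (Finset.sum_nonneg fun _ _ => sq_nonneg _)]
  exact key

theorem euclNorm_mulVec_of_transpose_mul_self {m n : Type*} [Fintype m] [Fintype n]
    [DecidableEq n] {W : Matrix m n ℝ} (hW : Wᵀ * W = 1) (x : n → ℝ) :
    euclNorm (W *ᵥ x) = euclNorm x := by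
  have h' : W *ᵥ x ⬝ᵥ W *ᵥ x = x ⬝ᵥ x := by
    rw [dotProduct_mulVec, vecMul_mulVec, hW, vecMul_one]
  rw [euclNorm, euclNorm]
  congr 1
  simpa [dotProduct, sq] using h'

theorem euclNorm_transpose_mulVec_le {m n : Type*} [Fintype m] [Fintype n]
    [DecidableEq n] {W : Matrix m n ℝ} (hW : Wᵀ * W = 1) (x : m → ℝ) :
    euclNorm (Wᵀ *ᵥ x) ≤ euclNorm x := by
  have h' : Wᵀ *ᵥ x ⬝ᵥ Wᵀ *ᵥ x = x ⬝ᵥ W *ᵥ (Wᵀ *ᵥ x) := by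
    rw [dotProduct_mulVec x, ← mulVec_transpose]
  have h2 : W *ᵥ (Wᵀ *ᵥ x) ⬝ᵥ W *ᵥ (Wᵀ *ᵥ x) = Wᵀ *ᵥ x ⬝ᵥ Wᵀ *ᵥ x := by
    rw [dotProduct_mulVec, vecMul_mulVec, hW, vecMul_one]
  have h3 : 0 ≤ (x - W *ᵥ (Wᵀ *ᵥ x)) ⬝ᵥ (x - W *ᵥ (Wᵀ *ᵥ x)) :=
    Finset.sum_nonneg fun _ _ => mul_self_nonneg _
  simp only [sub_dotProduct, dotProduct_sub] at h3
  rw [dotProduct_comm (W *ᵥ (Wᵀ *ᵥ x)) x] at h3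
  have h4 : Wᵀ *ᵥ x ⬝ᵥ Wᵀ *ᵥ x ≤ x ⬝ᵥ x := by linarith
  refine Real.sqrt_le_sqrt ?_
  simpa [dotProduct, sq] using h4

theorem euclNorm_mulVec_le_specNorm {m n : Type*} [Fintype m] [Fintype n] [DecidableEq n]
    (M : Matrix m n ℝ) (x : n → ℝ) : euclNorm (M *ᵥ x) ≤ specNorm M * euclNorm x := by
  rw [euclNorm_eq_norm, euclNorm_eq_norm]
  exact (LinearMap.toContinuousLinearMap (Matrix.toEuclideanLin M)).le_opNorm (WithLp.toLp 2 x)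

theorem euclNorm_le_add {n : Type*} [Fintype n] (x y : n → ℝ) :
    euclNorm x ≤ euclNorm (x + y) + euclNorm y := by
  simp only [euclNorm_eq_norm, WithLp.toLp_add]
  simpa using norm_sub_le (WithLp.toLp 2 x + WithLp.toLp 2 y) (WithLp.toLp 2 y)

/-- Perturbation bound for the projected matrix `(T + Z) * (Wh * Whᵀ)`, when the rows of `T` lie
in the column space of `W` and `Wᵀ * Wh` is bounded below. -/
theorem sValGe_add_mul_projection {m n k : Type*} [Fintype m] [Fintype n] [Fintype k]
    [DecidableEq n] [DecidableEq k] {T Z : Matrix m n ℝ} {W Wh : Matrix n k ℝ}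
    (hW : Wᵀ * W = 1) (hWh : Whᵀ * Wh = 1) (hT : T = T * (W * Wᵀ)) {lam c e : ℝ}
    (hlam : 0 < lam) (hc : 0 < c) {r : ℕ} (hsv : sValGe T r lam)
    (hmin : ∀ x, c * euclNorm x ≤ euclNorm ((Wᵀ * Wh) *ᵥ x))
    (hZ : specNorm (Z * (Wh * Whᵀ)) ≤ e) :
    sValGe ((T + Z) * (Wh * Whᵀ)) r (c * lam - e) := by
  obtain ⟨V, hV, hTV⟩ := hsv
  have hinj : Function.Injective (Wᵀ * Wh).mulVec := by
    rw [← Matrix.coe_mulVecLin, injective_iff_map_eq_zero]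
    intro x hx
    have h := hmin x
    rw [← Matrix.mulVecLin_apply, hx, euclNorm_eq_norm, euclNorm_eq_norm, WithLp.toLp_zero,
      norm_zero] at h
    have h0 : ‖WithLp.toLp 2 x‖ = 0 :=
      le_antisymm (nonpos_of_mul_nonpos_right h hc) (norm_nonneg _)
    simpa using h0
  have hG : IsUnit (Wᵀ * Wh) := Matrix.mulVec_injective_iff_isUnit.mp hinj
  have hdet : IsUnit (Wᵀ * Wh).det := (Matrix.isUnit_iff_isUnit_det _).mp hG
  set L : Matrix n n ℝ := Wh * ((Wᵀ * Wh)⁻¹ * Wᵀ) with hL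
  have hWL : Wᵀ * L = Wᵀ := by
    rw [hL, ← Matrix.mul_assoc, ← Matrix.mul_assoc, Matrix.mul_nonsing_inv _ hdet, Matrix.one_mul]
  have hTL : T * L = T := by
    rw [hT, Matrix.mul_assoc, Matrix.mul_assoc, hWL]
  have hPL : Wh * Whᵀ * L = L := by
    rw [hL, Matrix.mul_assoc, ← Matrix.mul_assoc Whᵀ, hWh, Matrix.one_mul]
  have hLnorm : ∀ x, c * euclNorm (L *ᵥ x) ≤ euclNorm x := by
    intro x
    have h := hmin (((Wᵀ * Wh)⁻¹ * Wᵀ) *ᵥ x)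
    rw [Matrix.mulVec_mulVec, ← Matrix.mul_assoc, Matrix.mul_nonsing_inv _ hdet,
      Matrix.one_mul] at h
    rw [hL, ← Matrix.mulVec_mulVec, euclNorm_mulVec_of_transpose_mul_self hWh]
    exact h.trans (euclNorm_transpose_mulVec_le hW x)
  have hTV' : ∀ x ∈ V, lam * euclNorm x.ofLp ≤ euclNorm (T *ᵥ x.ofLp) := by
    intro x hx
    rw [euclNorm_eq_norm, euclNorm_eq_norm]
    exact hTV x hx
  refine ⟨V.map (Matrix.toEuclideanLin L), ?_, ?_⟩
  · rw [← LinearMap.range_domRestrict, ← hV]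
    refine LinearMap.finrank_range_of_inj ((injective_iff_map_eq_zero _).mpr ?_)
    rintro ⟨x, hx⟩ h
    have hLx : L *ᵥ x.ofLp = 0 := congrArg WithLp.ofLp h
    have hTx := hTV' x hx
    rw [← hTL, ← Matrix.mulVec_mulVec, hLx, Matrix.mulVec_zero, euclNorm_eq_norm,
      euclNorm_eq_norm, WithLp.toLp_zero, norm_zero] at hTx
    have h0 : ‖x‖ = 0 := le_antisymm (nonpos_of_mul_nonpos_right hTx hlam) (norm_nonneg _)
    simpa using h0
  · rintro _ ⟨x, hx, rfl⟩
    have hy : Matrix.toEuclideanLin L x = WithLp.toLp 2 (L *ᵥ x.ofLp) := rfl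
    have e1 : (T + Z) * (Wh * Whᵀ) * L = T + Z * (Wh * Whᵀ) * L := by
      rw [Matrix.add_mul, Matrix.add_mul, Matrix.mul_assoc T, hPL, hTL]
    rw [hy, Matrix.toLpLin_toLp, ← euclNorm_eq_norm, Matrix.toLin'_apply, ← euclNorm_eq_norm,
      Matrix.mulVec_mulVec, e1, Matrix.add_mulVec]
    have h1 := euclNorm_le_add (T *ᵥ x.ofLp) ((Z * (Wh * Whᵀ) * L) *ᵥ x.ofLp)
    have h2 := euclNorm_mulVec_le_specNorm (Z * (Wh * Whᵀ)) (L *ᵥ x.ofLp)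
    rw [Matrix.mulVec_mulVec] at h2
    have h3 : specNorm (Z * (Wh * Whᵀ)) * euclNorm (L *ᵥ x.ofLp) ≤ e * euclNorm (L *ᵥ x.ofLp) :=
      mul_le_mul_of_nonneg_right hZ (Real.sqrt_nonneg _)
    have h4 := mul_le_mul_of_nonneg_left (hLnorm x.ofLp) hlam.le
    have h5 := hTV' x hx
    linarith

/-- lower bound on the `r₁`-th singular value of the projected noisy
matricization. -/
theorem stmt10 (p₁ p₂ p₃ r₁ r₂ r₃ : ℕ)
    (T₁ Z₁ : Matrix (Fin p₁) (Fin p₂ × Fin p₃) ℝ)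
    (U₂ Uh₂ : Matrix (Fin p₂) (Fin r₂) ℝ) (U₃ Uh₃ : Matrix (Fin p₃) (Fin r₃) ℝ)
    (hU₂ : U₂ᵀ * U₂ = 1) (hUh₂ : Uh₂ᵀ * Uh₂ = 1)
    (hU₃ : U₃ᵀ * U₃ = 1) (hUh₃ : Uh₃ᵀ * Uh₃ = 1)
    (lam : ℝ) (hlam : 0 < lam)
    (hT : T₁ = T₁ * ((U₂ * U₂ᵀ) ⊗ₖ (U₃ * U₃ᵀ)))
    (hsv : sValGe T₁ r₁ lam)
    (hmin₂ : ∀ x : Fin r₂ → ℝ, 7 / 8 * euclNorm x ≤ euclNorm ((U₂ᵀ * Uh₂).mulVec x))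
    (hmin₃ : ∀ x : Fin r₃ → ℝ, 7 / 8 * euclNorm x ≤ euclNorm ((U₃ᵀ * Uh₃).mulVec x))
    (hZ : specNorm (Z₁ * ((Uh₂ * Uh₂ᵀ) ⊗ₖ (Uh₃ * Uh₃ᵀ))) ≤ lam / 8) :
    sValGe ((T₁ + Z₁) * ((Uh₂ * Uh₂ᵀ) ⊗ₖ (Uh₃ * Uh₃ᵀ))) r₁ (5 / 8 * lam) := by
  have hk : ∀ (A : Matrix (Fin p₂) (Fin r₂) ℝ) (B : Matrix (Fin p₃) (Fin r₃) ℝ),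
      (A * Aᵀ) ⊗ₖ (B * Bᵀ) = (A ⊗ₖ B) * (A ⊗ₖ B)ᵀ := fun A B => by
    rw [mul_kronecker_mul, kroneckerMap_transpose]
  have ho : ∀ {A : Matrix (Fin p₂) (Fin r₂) ℝ} {B : Matrix (Fin p₃) (Fin r₃) ℝ},
      Aᵀ * A = 1 → Bᵀ * B = 1 → (A ⊗ₖ B)ᵀ * (A ⊗ₖ B) = 1 := fun hA hB => by
    rw [← kroneckerMap_transpose, ← mul_kronecker_mul, hA, hB, one_kronecker_one]
  rw [hk] at hT hZ ⊢
  have hmin : ∀ x, 7 / 8 * (7 / 8) * euclNorm x ≤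
      euclNorm (((U₂ ⊗ₖ U₃)ᵀ * (Uh₂ ⊗ₖ Uh₃)) *ᵥ x) := by
    rw [← kroneckerMap_transpose, ← mul_kronecker_mul]
    exact kronecker_mulVec_lower_bound (by norm_num) (by norm_num) hmin₂ hmin₃
  obtain ⟨V, hV, h⟩ := sValGe_add_mul_projection (ho hU₂ hU₃) (ho hUh₂ hUh₃) hT hlam
    (by norm_num) hsv hmin hZ
  refine ⟨V, hV, fun x hx => le_trans ?_ (h x hx)⟩
  gcongr
  linarith

end
end

section
/- Let U ∈ ℝ^{p×r} have orthonormal columns, let u denote the last column of U, and let 0 < δ ≤ 1/12. Let w = (I − UUᵀ)e₁ and define v = (u + δw)/√(1 + δ²‖w‖²) (a unit vector). Then: (i) ‖v − u‖_∞ ≤ δ‖w‖_∞ + (δ²/2)‖u‖_∞; (ii) ‖v − u‖₂ ≤ 3δ; and (iii) if in addition ‖e₁ᵀU‖ ≤ 1/2, then |v₁ − u₁| ≥ (δ/4)(1 − ‖e₁ᵀU‖²), where v₁ and u₁ denote the first coordinates of v and u. -/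
open MeasureTheory ProbabilityTheory Matrix
open scoped ENNReal NNReal Kronecker

noncomputable section

/-- The squared norm of `(I - UUᵀ)eᵢ` is its `i`-th coordinate. -/
lemma sum_sq_residual_single {m n : Type*} [Fintype m] [DecidableEq m] [Fintype n]
    [DecidableEq n] (U : Matrix m n ℝ) (hU : Uᵀ * U = 1) (i : m) :
    ∑ k, ((1 - U * Uᵀ) *ᵥ Pi.single i 1) k ^ 2 = ((1 - U * Uᵀ) *ᵥ Pi.single i 1) i := by
  have hsymm : (1 - U * Uᵀ)ᵀ = 1 - U * Uᵀ := by simp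
  have hidem : (1 - U * Uᵀ) * (1 - U * Uᵀ) = 1 - U * Uᵀ := by
    have h : U * Uᵀ * (U * Uᵀ) = U * Uᵀ := by
      rw [Matrix.mul_assoc, ← Matrix.mul_assoc Uᵀ, hU, Matrix.one_mul]
    rw [Matrix.mul_sub, Matrix.sub_mul, Matrix.sub_mul, h]
    simp
  generalize 1 - U * Uᵀ = P at hsymm hidem
  have h := congrFun (congrFun hidem i) i
  simp only [Matrix.mul_apply] at h
  simp only [Matrix.mulVec_single_one, Matrix.col_apply]
  rw [← h]
  refine Finset.sum_congr rfl fun k _ => ?_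
  rw [sq]
  congr 1
  exact congrFun (congrFun hsymm i) k

/-- The `i`-th coordinate of `(I - UUᵀ)eᵢ` is `1 - ‖eᵢᵀU‖²`. -/
lemma residual_single_apply_self {m n : Type*} [Fintype m] [DecidableEq m] [Fintype n]
    (U : Matrix m n ℝ) (i : m) :
    ((1 - U * Uᵀ) *ᵥ Pi.single i 1) i = 1 - ∑ s, U i s ^ 2 := by
  simp [Matrix.mul_apply, sq]

lemma euclNorm_nonneg {n : Type*} [Fintype n] (x : n → ℝ) : 0 ≤ euclNorm x :=
  Real.sqrt_nonneg _

lemma euclNorm_sq {n : Type*} [Fintype n] (x : n → ℝ) : euclNorm x ^ 2 = ∑ i, x i ^ 2 :=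
  Real.sq_sqrt (Finset.sum_nonneg fun _ _ => sq_nonneg _)

lemma one_sub_half_le_inv_sqrt {x : ℝ} (hx : 0 ≤ x) : 1 - x / 2 ≤ (√(1 + x))⁻¹ := by
  have hpos : 0 < √(1 + x) := Real.sqrt_pos.2 (by linarith)
  have hle : √(1 + x) ≤ 1 + x / 2 := Real.sqrt_one_add_le (by linarith)
  rw [← one_div, le_div_iff₀ hpos]
  rcases le_total 0 (1 - x / 2) with h | h
  · nlinarith [sq_nonneg x]
  · nlinarith

lemma inv_sqrt_one_add_le_one {x : ℝ} (hx : 0 ≤ x) : (√(1 + x))⁻¹ ≤ 1 :=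
  inv_le_one_of_one_le₀ (Real.one_le_sqrt.2 (by linarith))

/-- perturbing the last column of `U` in the direction `(I - UUᵀ)e₁`. -/
theorem stmt11 (p r : ℕ) (hp : 0 < p) (hr : 0 < r)
    (U : Matrix (Fin p) (Fin r) ℝ) (hU : Uᵀ * U = 1)
    (δ : ℝ) (hδ0 : 0 < δ) (hδ : δ ≤ 1 / 12)
    (u w v : Fin p → ℝ)
    (hu : u = fun i => U i ⟨r - 1, Nat.sub_lt hr Nat.one_pos⟩)
    (hw : w = ((1 : Matrix (Fin p) (Fin p) ℝ) - U * Uᵀ).mulVec (Pi.single ⟨0, hp⟩ 1))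
    (hv : v = fun i => (u i + δ * w i) / Real.sqrt (1 + δ ^ 2 * euclNorm w ^ 2)) :
    (⨆ i, |v i - u i|) ≤ δ * (⨆ i, |w i|) + δ ^ 2 / 2 * (⨆ i, |u i|) ∧
    euclNorm (fun i => v i - u i) ≤ 3 * δ ∧
    (euclNorm (fun s => U ⟨0, hp⟩ s) ≤ 1 / 2 →
      δ / 4 * (1 - euclNorm (fun s => U ⟨0, hp⟩ s) ^ 2) ≤ |v ⟨0, hp⟩ - u ⟨0, hp⟩|) := by
  have : Nonempty (Fin p) := ⟨⟨0, hp⟩⟩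
  have hsum_u : ∑ i, u i ^ 2 = 1 := by
    have h := congrFun (congrFun hU ⟨r - 1, Nat.sub_lt hr Nat.one_pos⟩)
      ⟨r - 1, Nat.sub_lt hr Nat.one_pos⟩
    simpa [Matrix.mul_apply, hu, sq] using h
  have hsum_w : ∑ i, w i ^ 2 = w ⟨0, hp⟩ := by
    rw [hw]; exact sum_sq_residual_single U hU _
  have hw0 : w ⟨0, hp⟩ = 1 - euclNorm (fun s => U ⟨0, hp⟩ s) ^ 2 := by
    rw [euclNorm_sq, hw]; exact residual_single_apply_self U _
  have hu0 : u ⟨0, hp⟩ ^ 2 ≤ euclNorm (fun s => U ⟨0, hp⟩ s) ^ 2 := by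
    rw [euclNorm_sq, hu]
    exact Finset.single_le_sum (f := fun s => U ⟨0, hp⟩ s ^ 2) (fun _ _ => sq_nonneg _)
      (Finset.mem_univ _)
  have hq0 : 0 ≤ w ⟨0, hp⟩ := hsum_w ▸ Finset.sum_nonneg fun _ _ => sq_nonneg _
  have hq1 : w ⟨0, hp⟩ ≤ 1 := by rw [hw0]; linarith [sq_nonneg (euclNorm fun s => U ⟨0, hp⟩ s)]
  have hx : 0 ≤ δ ^ 2 * w ⟨0, hp⟩ := by positivity
  have hc := one_sub_half_le_inv_sqrt hx
  have hc1 := inv_sqrt_one_add_le_one hx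
  have hc0 : 0 ≤ (√(1 + δ ^ 2 * w ⟨0, hp⟩))⁻¹ := by positivity
  have hdiff (i : Fin p) : v i - u i =
      (√(1 + δ ^ 2 * w ⟨0, hp⟩))⁻¹ * (δ * w i) - (1 - (√(1 + δ ^ 2 * w ⟨0, hp⟩))⁻¹) * u i := by
    simp only [hv, euclNorm_sq, hsum_w, div_eq_mul_inv]
    ring
  generalize (√(1 + δ ^ 2 * w ⟨0, hp⟩))⁻¹ = c at hc hc1 hc0 hdiff
  have hcδ : 1 - c ≤ δ ^ 2 / 2 := by nlinarith [sq_nonneg δ]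
  have habs (i : Fin p) : |v i - u i| ≤ δ * |w i| + δ ^ 2 / 2 * |u i| := by
    rw [hdiff]
    refine (abs_sub _ _).trans ?_
    rw [abs_mul, abs_mul, abs_mul, abs_of_nonneg hc0, abs_of_pos hδ0,
      abs_of_nonneg (sub_nonneg.2 hc1)]
    exact add_le_add (mul_le_of_le_one_left (by positivity) hc1)
      (mul_le_mul_of_nonneg_right hcδ (abs_nonneg _))
  refine ⟨?_, ?_, fun hrow => ?_⟩
  · refine ciSup_le fun i => (habs i).trans ?_
    gcongr
    · exact le_ciSup (f := fun i => |w i|) (Set.finite_range _).bddAbove i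
    · exact le_ciSup (f := fun i => |u i|) (Set.finite_range _).bddAbove i
  · refine Real.sqrt_le_iff.2 ⟨by positivity, ?_⟩
    calc ∑ i, (v i - u i) ^ 2
        ≤ ∑ i, (2 * δ ^ 2 * w i ^ 2 + δ ^ 4 / 2 * u i ^ 2) := by
          refine Finset.sum_le_sum fun i _ => ?_
          rw [← sq_abs, ← sq_abs (w i), ← sq_abs (u i)]
          have h := pow_le_pow_left₀ (abs_nonneg _) (habs i) 2
          nlinarith [sq_nonneg (δ * |w i| - δ ^ 2 / 2 * |u i|)]
      _ = 2 * δ ^ 2 * w ⟨0, hp⟩ + δ ^ 4 / 2 := by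
          rw [Finset.sum_add_distrib, ← Finset.mul_sum, ← Finset.mul_sum, hsum_w, hsum_u, mul_one]
      _ ≤ (3 * δ) ^ 2 := by
          have h1 : δ ^ 2 ≤ 1 := by nlinarith
          nlinarith [sq_nonneg δ, mul_le_mul_of_nonneg_left hq1 (sq_nonneg δ),
            mul_le_mul_of_nonneg_left h1 (sq_nonneg δ)]
  · have hu_half : u ⟨0, hp⟩ ≤ 1 / 2 :=
      (le_abs_self _).trans ((abs_le_of_sq_le_sq hu0 (euclNorm_nonneg _)).trans hrow)
    rw [← hw0]
    refine le_trans ?_ (le_abs_self _)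
    rw [hdiff]
    generalize w ⟨0, hp⟩ = q at *
    have hδq : 0 ≤ δ * q := by positivity
    have hc_half : 1 / 2 ≤ c := by nlinarith
    have h1 : 1 / 2 * (δ * q) ≤ c * (δ * q) := mul_le_mul_of_nonneg_right hc_half hδq
    have h2 : (1 - c) * u ⟨0, hp⟩ ≤ (1 - c) * (1 / 2) :=
      mul_le_mul_of_nonneg_left hu_half (sub_nonneg.2 hc1)
    have h3 : δ * (δ * q) ≤ 1 / 12 * (δ * q) := mul_le_mul_of_nonneg_right hδ hδq
    nlinarith

end
end
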